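/- Let Σ_V be the bouquet shift with a(n) = 1 for all n ≥ 1, and define φ : Σ_V → ℝ by φ = −log 2 on [rr], φ = −n log 2 on the 2-cylinder [r v_1^{n,1}] for each n ≥ 2, and φ = 0 elsewhere. Then: (i) the Gurevich pressure satisfies P(φ) = 0; (ii) φ is positive recurrent; (iii) every periodic point x of period n satisfies (1/n)S_nφ(x) = −log 2, so χ_per(φ) = −log 2 < P(φ) and condition (UCS) holds; (iv) for every n ∈ ℕ, sup_{x ∈ Σ_V} S_nφ(x) = 0, so the hyperbolicity condition (there exists n with sup_x S_nφ(x)/n < P(φ)) fails. -/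

import Mathlib

open Filter Set MeasureTheory Real ENNReal

namespace CMS

/-- Points of the full sequence space over the alphabet `ℕ`. -/
abbrev Pt : Type := ℕ → ℕ

/-- The (left) shift map `σ`. -/
def shiftMap : Pt → Pt := fun x i => x (i + 1)

/-- `x` is a point of the countable Markov shift `Σ` determined by the
transition matrix `M` (identified with a relation on the alphabet `ℕ`). -/
def isAdmissible (M : ℕ → ℕ → Prop) (x : Pt) : Prop := ∀ i, M (x i) (x (i + 1))

/-- Topological transitivity: for all states `a, b` there is `N` with
`[a] ∩ σ⁻ᴺ [b] ≠ ∅`. -/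
def TopTransitive (M : ℕ → ℕ → Prop) : Prop :=
  ∀ a b : ℕ, ∃ (N : ℕ) (x : Pt), isAdmissible M x ∧ x 0 = a ∧ x N = b

/-- Birkhoff sum `S_n φ`. -/
noncomputable def birkhoff (φ : Pt → ℝ) (n : ℕ) (x : Pt) : ℝ :=
  ∑ i ∈ Finset.range n, φ (shiftMap^[i] x)

/-- `φ` has summable variations: `∑_{k ≥ 2} var_k(φ) < ∞`, expressed via a summable
sequence dominating the `k`-th variations. -/
def SummableVariations (M : ℕ → ℕ → Prop) (φ : Pt → ℝ) : Prop :=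
  ∃ V : ℕ → ℝ, Summable V ∧
    ∀ k, 2 ≤ k → ∀ x y : Pt, isAdmissible M x → isAdmissible M y →
      (∀ i < k, x i = y i) → |φ x - φ y| ≤ V k

/-- `φ` is weakly Hölder continuous: `var_k(φ) ≤ C θ^k` for all `k ≥ 2`. -/
def WeaklyHolder (M : ℕ → ℕ → Prop) (φ : Pt → ℝ) : Prop :=
  ∃ C θ : ℝ, 0 < C ∧ 0 < θ ∧ θ < 1 ∧
    ∀ k, 2 ≤ k → ∀ x y : Pt, isAdmissible M x → isAdmissible M y →
      (∀ i < k, x i = y i) → |φ x - φ y| ≤ C * θ ^ k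

/-- Periodic points of period `n` in the 1-cylinder `[a]`. -/
def PerSet (M : ℕ → ℕ → Prop) (a n : ℕ) : Set Pt :=
  {x | isAdmissible M x ∧ shiftMap^[n] x = x ∧ x 0 = a}

/-- Periodic points of period `n` in `[a]` whose first return time to `[a]` is `n`. -/
def PerStarSet (M : ℕ → ℕ → Prop) (a n : ℕ) : Set Pt :=
  {x | isAdmissible M x ∧ shiftMap^[n] x = x ∧ x 0 = a ∧ ∀ k, 0 < k → k < n → x k ≠ a}

/-- The Gurevich partition function `Z_n(φ, a)`. -/
noncomputable def Zn (M : ℕ → ℕ → Prop) (φ : Pt → ℝ) (a n : ℕ) : ℝ≥0∞ :=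
  ∑' x : PerSet M a n, ENNReal.ofReal (Real.exp (birkhoff φ n x.1))

/-- The first-return partition function `Z_n^*(φ, a)`. -/
noncomputable def ZnStar (M : ℕ → ℕ → Prop) (φ : Pt → ℝ) (a n : ℕ) : ℝ≥0∞ :=
  ∑' x : PerStarSet M a n, ENNReal.ofReal (Real.exp (birkhoff φ n x.1))

/-- The Gurevich pressure at the state `a`:
`P(φ) = limsup_n (1/n) log Z_n(φ, a)`, with values in `EReal`. -/
noncomputable def pressureAt (M : ℕ → ℕ → Prop) (φ : Pt → ℝ) (a : ℕ) : EReal :=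
  Filter.limsup (fun n : ℕ => ((n : ℝ)⁻¹ : EReal) * ENNReal.log (Zn M φ a n)) atTop

/-- `limsup_n (1/n) log Z_n^*(φ, a)`, with values in `EReal`. -/
noncomputable def pressureStarAt (M : ℕ → ℕ → Prop) (φ : Pt → ℝ) (a : ℕ) : EReal :=
  Filter.limsup (fun n : ℕ => ((n : ℝ)⁻¹ : EReal) * ENNReal.log (ZnStar M φ a n)) atTop

/-- Strong positive recurrence of `φ`, relative to the common value `P` of the
Gurevich pressure: for some state `a`, `limsup_n (1/n) log Z_n^*(φ,a) < P(φ)`. -/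
def SPR (M : ℕ → ℕ → Prop) (φ : Pt → ℝ) (P : ℝ) : Prop :=
  ∃ a : ℕ, pressureStarAt M φ a < (P : EReal)

/-- The `F`-property: for every state `a` and every `n ≥ 1` there are only finitely
many periodic points of period `n` in `[a]`. -/
def FProperty (M : ℕ → ℕ → Prop) : Prop :=
  ∀ a n : ℕ, 0 < n → (PerSet M a n).Finite

/-- `χ_per(φ) = sup { (1/n) S_n φ(x) : σ^n x = x, n ∈ ℕ }`, with values in `EReal`. -/
noncomputable def chiPer (M : ℕ → ℕ → Prop) (φ : Pt → ℝ) : EReal :=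
  ⨆ p : {p : Pt × ℕ // isAdmissible M p.1 ∧ 0 < p.2 ∧ shiftMap^[p.2] p.1 = p.1},
    ((birkhoff φ p.1.2 p.1.1 / (p.1.2 : ℝ) : ℝ) : EReal)

/-- `x` lies in a cylinder belonging to `B(n, M', q)`: it is admissible,
`x 0 ≤ q`, `x n ≤ q` and `#{0 ≤ k ≤ n : x k ≤ q} ≤ (n+1)/M'`. -/
def inBSet (M : ℕ → ℕ → Prop) (n M' q : ℕ) (x : Pt) : Prop :=
  isAdmissible M x ∧ x 0 ≤ q ∧ x n ≤ q ∧
    ((((Finset.range (n + 1)).filter (fun k => x k ≤ q)).card : ℝ) ≤ (n + 1 : ℝ) / (M' : ℝ))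

/-- `z_{φ,n}(M',q) = sup { (1/n) S_n φ(x) : x ∈ B for some B ∈ B(n,M',q) }`. -/
noncomputable def zPhi (M : ℕ → ℕ → Prop) (φ : Pt → ℝ) (n M' q : ℕ) : EReal :=
  ⨆ x : {x : Pt // inBSet M n M' q x}, ((birkhoff φ n x.1 / (n : ℝ) : ℝ) : EReal)

/-- The contraction at infinity
`δ_{φ,∞} = lim_{q→∞} lim_{M'→∞} limsup_{n→∞} z_{φ,n}(M',q)`
(the inner limits exist by monotonicity, so they agree with `liminf`s). -/
noncomputable def deltaInf (M : ℕ → ℕ → Prop) (φ : Pt → ℝ) : EReal :=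
  liminf (fun q : ℕ => liminf (fun M' : ℕ =>
    limsup (fun n : ℕ => zPhi M φ n M' q) atTop) atTop) atTop

/-- `z_n(M',q) = #B(n,M',q)`, the number of `(n+1)`-cylinders (i.e. admissible
words realized in `Σ`) in `B(n,M',q)`, counted in `ℝ≥0∞`. -/
noncomputable def zCount (M : ℕ → ℕ → Prop) (n M' q : ℕ) : ℝ≥0∞ :=
  ∑' _w : {w : Fin (n + 1) → ℕ //
      (∃ x : Pt, isAdmissible M x ∧ ∀ i : Fin (n + 1), x (i : ℕ) = w i) ∧
      w 0 ≤ q ∧ w (Fin.last n) ≤ q ∧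
      (((Finset.univ.filter (fun i : Fin (n + 1) => w i ≤ q)).card : ℝ) ≤ (n + 1 : ℝ) / (M' : ℝ))},
    (1 : ℝ≥0∞)

/-- The entropy at infinity
`h_∞ = lim_{q→∞} lim_{M'→∞} limsup_{n→∞} (1/n) log z_n(M',q)`. -/
noncomputable def hInfty (M : ℕ → ℕ → Prop) : EReal :=
  liminf (fun q : ℕ => liminf (fun M' : ℕ =>
    limsup (fun n : ℕ => ((n : ℝ)⁻¹ : EReal) * ENNReal.log (zCount M n M' q)) atTop) atTop) atTop

end CMS

namespace CMS

/-- The vertex set of the bouquet graph determined by `a : ℕ → ℕ` (with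
`a 1 ≤ 1`): the root, encoded as `(0,0,0)`, together with the vertices
`v_k^{n,i}` (encoded `(n,i,k)`) for `n ≥ 2`, `1 ≤ i ≤ a n`, `1 ≤ k ≤ n-1`. -/
def BouquetVertex (a : ℕ → ℕ) : Set (ℕ × ℕ × ℕ) :=
  {p | p = (0, 0, 0) ∨
    (2 ≤ p.1 ∧ 1 ≤ p.2.1 ∧ p.2.1 ≤ a p.1 ∧ 1 ≤ p.2.2 ∧ p.2.2 ≤ p.1 - 1)}

/-- The edges of the bouquet graph determined by `a : ℕ → ℕ`: the transitions
along the `a n` disjoint simple loops of length `n` based at the root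
(`a 1 = 1` meaning the self-loop at the root is present). -/
def BouquetEdge (a : ℕ → ℕ) : (ℕ × ℕ × ℕ) → (ℕ × ℕ × ℕ) → Prop := fun u v =>
  (u = (0, 0, 0) ∧ v = (0, 0, 0) ∧ a 1 = 1) ∨
  (u = (0, 0, 0) ∧ ∃ n i : ℕ, 2 ≤ n ∧ 1 ≤ i ∧ i ≤ a n ∧ v = (n, i, 1)) ∨
  (∃ n i k : ℕ, 2 ≤ n ∧ 1 ≤ i ∧ i ≤ a n ∧ 1 ≤ k ∧ k + 1 ≤ n - 1 ∧
    u = (n, i, k) ∧ v = (n, i, k + 1)) ∨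
  (∃ n i : ℕ, 2 ≤ n ∧ 1 ≤ i ∧ i ≤ a n ∧ u = (n, i, n - 1) ∧ v = (0, 0, 0))

/-- The transition matrix `M` on the alphabet `ℕ` is (a presentation of) the
bouquet shift `Σ_V` of `a`, via the enumeration `e` of the vertices with
`e 0` the root.  (All the quantities appearing in our statements are
independent of the chosen enumeration.) -/
def IsBouquet (a : ℕ → ℕ) (M : ℕ → ℕ → Prop) (e : ℕ → ℕ × ℕ × ℕ) : Prop :=
  Function.Injective e ∧ Set.range e = BouquetVertex a ∧ e 0 = (0, 0, 0) ∧
    ∀ u v : ℕ, M u v ↔ BouquetEdge a (e u) (e v)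

end CMS

namespace CMS

/-- A walk in the bouquet graph with exactly one loop of each length. -/
def IsBouquetWalk (y : ℕ → ℕ × ℕ × ℕ) : Prop :=
  ∀ t, BouquetEdge (fun _ => 1) (y t) (y (t + 1))

/-- `p < q` are consecutive elements of `S`. -/
def IsGap (S : ℕ → Prop) (p q : ℕ) : Prop :=
  S p ∧ S q ∧ p < q ∧ ∀ j, p < j → j < q → ¬ S j

theorem exists_isGap {S : ℕ → Prop} {p₀ t : ℕ} (hp : S p₀) (hpt : p₀ ≤ t)
    (hq : ∃ q, t < q ∧ S q) : ∃ p q, p ≤ t ∧ t < q ∧ IsGap S p q := by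
  classical
  refine ⟨Nat.findGreatest S t, Nat.find hq, Nat.findGreatest_le t, (Nat.find_spec hq).1,
    Nat.findGreatest_spec hpt hp, (Nat.find_spec hq).2,
    (Nat.findGreatest_le t).trans_lt (Nat.find_spec hq).1, fun j h₁ h₂ hj => ?_⟩
  rcases le_or_gt j t with h | h
  · exact Nat.findGreatest_is_greatest h₁ h hj
  · exact Nat.find_min hq h₂ ⟨h, hj⟩

theorem IsGap.unique {S : ℕ → Prop} {p q p' q' t : ℕ} (h : IsGap S p q) (h' : IsGap S p' q')
    (hp : p ≤ t) (hq : t < q) (hp' : p' ≤ t) (hq' : t < q') : p = p' ∧ q = q' := by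
  obtain ⟨a1, a2, a3, a4⟩ := h
  obtain ⟨b1, b2, b3, b4⟩ := h'
  constructor
  · rcases lt_trichotomy p p' with h | h | h
    · exact absurd b1 (a4 _ h (by omega))
    · exact h
    · exact absurd a1 (b4 _ h (by omega))
  · rcases lt_trichotomy q q' with h | h | h
    · exact absurd a2 (b4 _ (by omega) h)
    · exact h
    · exact absurd b2 (a4 _ (by omega) h)

theorem bouquetEdge_one_iff {u v : ℕ × ℕ × ℕ} : BouquetEdge (fun _ => 1) u v ↔
    (u = (0, 0, 0) ∧ v = (0, 0, 0)) ∨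
    (u = (0, 0, 0) ∧ ∃ n, 2 ≤ n ∧ v = (n, 1, 1)) ∨
    (∃ n k, 1 ≤ k ∧ k + 2 ≤ n ∧ u = (n, 1, k) ∧ v = (n, 1, k + 1)) ∨
    (∃ n, 1 ≤ n ∧ u = (n + 1, 1, n) ∧ v = (0, 0, 0)) := by
  constructor
  · rintro (⟨h1, h2, -⟩ | ⟨h1, n, i, h2, h3, h4, h5⟩ | ⟨n, i, k, h1, h2, h3, h4, h5, h6, h7⟩ |
      ⟨n, i, h1, h2, h3, h4, h5⟩)
    · exact Or.inl ⟨h1, h2⟩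
    · obtain rfl : i = 1 := le_antisymm h4 h3
      exact Or.inr (Or.inl ⟨h1, n, h2, h5⟩)
    · obtain rfl : i = 1 := le_antisymm h3 h2
      exact Or.inr (Or.inr (Or.inl ⟨n, k, h4, by omega, h6, h7⟩))
    · obtain rfl : i = 1 := le_antisymm h3 h2
      exact Or.inr (Or.inr (Or.inr ⟨n - 1, by omega, by rw [h4, Nat.sub_add_cancel (by omega)],
        h5⟩))
  · rintro (⟨h1, h2⟩ | ⟨h1, n, h2, h3⟩ | ⟨n, k, h1, h2, h3, h4⟩ | ⟨n, h1, h2, h3⟩)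
    · exact Or.inl ⟨h1, h2, rfl⟩
    · exact Or.inr (Or.inl ⟨h1, n, 1, h2, le_rfl, le_rfl, h3⟩)
    · exact Or.inr (Or.inr (Or.inl ⟨n, 1, k, by omega, le_rfl, le_rfl, h1, by omega, h3, h4⟩))
    · exact Or.inr (Or.inr (Or.inr ⟨n + 1, 1, by omega, le_rfl, le_rfl, h2, h3⟩))

namespace IsBouquetWalk

variable {y z : ℕ → ℕ × ℕ × ℕ}

theorem eq_of_mem_loop (hy : IsBouquetWalk y) {t m k : ℕ} (h : y t = (m, 1, k)) :
    ∀ j, k + j < m → y (t + j) = (m, 1, k + j) := by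
  intro j
  induction j with
  | zero => intro _; simpa using h
  | succ j ih =>
    intro hj
    have hs := bouquetEdge_one_iff.1 (hy (t + j))
    rw [ih (by omega)] at hs
    simp only [Prod.mk.injEq] at hs
    rcases hs with ⟨_, _⟩ | ⟨_, _⟩ | ⟨n, k', _, _, ⟨rfl, _, rfl⟩, h4⟩ | ⟨n, _, ⟨h1, _, h2⟩, _⟩
    · omega
    · omega
    · rw [← add_assoc, h4, add_assoc]
    · omega

theorem root_of_mem_loop (hy : IsBouquetWalk y) {t m k : ℕ} (hkm : k < m)
    (h : y t = (m, 1, k)) : y (t + (m - k)) = (0, 0, 0) := by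
  have h1 := hy.eq_of_mem_loop h (m - k - 1) (by omega)
  have hs := bouquetEdge_one_iff.1 (hy (t + (m - k - 1)))
  rw [h1, show t + (m - k - 1) + 1 = t + (m - k) by omega] at hs
  simp only [Prod.mk.injEq] at hs
  rcases hs with ⟨_, _⟩ | ⟨_, _⟩ | ⟨n, k', _, _, ⟨rfl, _, rfl⟩, h4⟩ | ⟨n, _, ⟨h1, _, h2⟩, h3⟩
  · omega
  · omega
  · omega
  · exact h3

theorem eq_root_or (hy : IsBouquetWalk y) (t : ℕ) :
    y t = (0, 0, 0) ∨ ∃ m k, 1 ≤ k ∧ k < m ∧ y t = (m, 1, k) := by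
  rcases bouquetEdge_one_iff.1 (hy t) with ⟨h, _⟩ | ⟨h, _⟩ | ⟨n, k, h1, h2, h, _⟩ | ⟨n, h1, h, _⟩
  · exact Or.inl h
  · exact Or.inl h
  · exact Or.inr ⟨n, k, h1, by omega, h⟩
  · exact Or.inr ⟨n + 1, n, h1, by omega, h⟩

theorem eq_root_or_of_root (hy : IsBouquetWalk y) {t : ℕ} (ht : y t = (0, 0, 0)) :
    y (t + 1) = (0, 0, 0) ∨ ∃ m, 2 ≤ m ∧ y (t + 1) = (m, 1, 1) := by
  have hs := bouquetEdge_one_iff.1 (hy t)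
  rw [ht] at hs
  simp only [Prod.mk.injEq] at hs
  rcases hs with ⟨_, h⟩ | ⟨_, n, h1, h⟩ | ⟨n, k, h1, h2, ⟨_, h, _⟩, _⟩ | ⟨n, h1, ⟨_, h, _⟩, _⟩
  · exact Or.inl h
  · exact Or.inr ⟨n, h1, h⟩
  · omega
  · omega

theorem exists_root_gt (hy : IsBouquetWalk y) (t : ℕ) : ∃ q, t < q ∧ y q = (0, 0, 0) := by
  rcases hy.eq_root_or (t + 1) with h | ⟨m, k, h1, h2, h⟩
  · exact ⟨t + 1, by omega, h⟩
  · exact ⟨_, by omega, hy.root_of_mem_loop h2 h⟩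

theorem eq_of_isGap (hy : IsBouquetWalk y) {p q : ℕ} (h : IsGap (fun t => y t = (0, 0, 0)) p q)
    {t : ℕ} (hp : p < t) (hq : t < q) : y t = (q - p, 1, t - p) := by
  obtain ⟨h1, h2, h3, h4⟩ := h
  rcases hy.eq_root_or_of_root h1 with h | ⟨m, hm, h⟩
  · exact absurd h (h4 _ (by omega) (by omega))
  · have hroot := hy.root_of_mem_loop (by omega) h
    have hmq : m = q - p := by
      rcases lt_trichotomy m (q - p) with h' | h' | h'
      · exact absurd hroot (h4 _ (by omega) (by omega))
      · exact h'
      · have := hy.eq_of_mem_loop h (q - p - 1) (by omega)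
        rw [show p + 1 + (q - p - 1) = q by omega, h2] at this
        simp at this
    have := hy.eq_of_mem_loop h (t - p - 1) (by omega)
    rwa [show p + 1 + (t - p - 1) = t by omega, show 1 + (t - p - 1) = t - p by omega, hmq]
      at this

theorem ext_of_periodic (hy : IsBouquetWalk y) (hz : IsBouquetWalk z) {n : ℕ} (hn : 0 < n)
    (hyn : Function.Periodic y n) (hzn : Function.Periodic z n)
    (h : ∀ i < n, y i = (0, 0, 0) ↔ z i = (0, 0, 0)) : y = z := by
  have hroot : ∀ i, y i = (0, 0, 0) ↔ z i = (0, 0, 0) := fun i => by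
    rw [← hyn.map_mod_nat i, ← hzn.map_mod_nat i]
    exact h _ (Nat.mod_lt _ hn)
  funext t
  obtain ⟨p₀, -, hp₀⟩ := hy.exists_root_gt 0
  obtain ⟨p, q, hp, hq, hg⟩ := exists_isGap (S := fun t => y t = (0, 0, 0)) (t := t + p₀ * n) hp₀
    (by nlinarith) (hy.exists_root_gt _)
  have hgz : IsGap (fun t => z t = (0, 0, 0)) p q := by simpa only [hroot] using hg
  have e1 : y (t + p₀ * n) = y t := hyn.nat_mul p₀ t
  have e2 : z (t + p₀ * n) = z t := hzn.nat_mul p₀ t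
  rw [← e1, ← e2]
  rcases hp.eq_or_lt with rfl | hp
  · rw [hg.1, hgz.1]
  · rw [hy.eq_of_isGap hg hp hq, hz.eq_of_isGap hgz hp hq]

end IsBouquetWalk

/-- Every unbounded set of times containing `0` is the set of root visits of a walk. -/
theorem exists_walk_of_root_times {S : ℕ → Prop} (h0 : S 0) (hS : ∀ t, ∃ q, t < q ∧ S q) :
    ∃ y, IsBouquetWalk y ∧ ∀ t, y t = (0, 0, 0) ↔ S t := by
  have hgap : ∀ t, ∃ p q, p ≤ t ∧ t < q ∧ IsGap S p q := fun t =>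
    exists_isGap h0 (Nat.zero_le t) (hS t)
  choose p q hp hq hg using hgap
  classical
  let y : ℕ → ℕ × ℕ × ℕ := fun t => if S t then (0, 0, 0) else (q t - p t, 1, t - p t)
  have hroot : ∀ t, y t = (0, 0, 0) ↔ S t := fun t => by
    by_cases h : S t <;> simp [y, h]
  refine ⟨y, fun t => bouquetEdge_one_iff.2 ?_, hroot⟩
  by_cases h1 : S t <;> by_cases h2 : S (t + 1)
  · exact Or.inl ⟨(hroot _).2 h1, (hroot _).2 h2⟩
  · refine Or.inr (Or.inl ⟨(hroot _).2 h1, q (t + 1) - p (t + 1), ?_, ?_⟩)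
    · have a1 := hp (t + 1)
      have a2 := hq (t + 1)
      have a3 : p (t + 1) ≠ t + 1 := fun h => h2 (h ▸ (hg (t + 1)).1)
      omega
    · have a1 := hp (t + 1)
      have a3 : p (t + 1) ≠ t + 1 := fun h => h2 (h ▸ (hg (t + 1)).1)
      have a4 : ¬ p (t + 1) < t := fun h => (hg (t + 1)).2.2.2 t h
        ((Nat.lt_succ_self t).trans (hq (t + 1))) h1
      simp only [y, h2, if_false, Prod.mk.injEq, true_and]
      omega
  · refine Or.inr (Or.inr (Or.inr ⟨t - p t, ?_, ?_, (hroot _).2 h2⟩))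
    · have a1 := hp t
      have a3 : p t ≠ t := fun h => h1 (h ▸ (hg t).1)
      omega
    · have a1 := hp t
      have a2 := hq t
      have a4 : ¬ t + 1 < q t := fun h => (hg t).2.2.2 (t + 1) (by omega) h h2
      simp only [y, h1, if_false, Prod.mk.injEq, and_true]
      omega
  · have a1 := hp t
    have a2 := hq t
    have a3 : p t ≠ t := fun h => h1 (h ▸ (hg t).1)
    have a4 : q t ≠ t + 1 := fun h => h2 (h ▸ (hg t).2.1)
    obtain ⟨e1, e2⟩ := (hg t).unique (hg (t + 1)) (t := t + 1) (by omega) (by omega) (hp _) (hq _)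
    refine Or.inr (Or.inr (Or.inl ⟨q t - p t, t - p t, by omega, by omega, ?_, ?_⟩))
    · simp [y, h1]
    · simp only [y, h2, if_false, Prod.mk.injEq, true_and]
      omega

theorem IsBouquetWalk.periodic_of_root_times {y : ℕ → ℕ × ℕ × ℕ} (hy : IsBouquetWalk y)
    (h0 : y 0 = (0, 0, 0)) {n : ℕ}
    (hper : ∀ t, y (t + n) = (0, 0, 0) ↔ y t = (0, 0, 0)) : Function.Periodic y n := by
  intro t
  obtain ⟨p, q, hp, hq, hg⟩ := exists_isGap (S := fun t => y t = (0, 0, 0)) h0 (Nat.zero_le t)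
    (hy.exists_root_gt t)
  have hg' : IsGap (fun t => y t = (0, 0, 0)) (p + n) (q + n) := by
    obtain ⟨h1, h2, h3, h4⟩ := hg
    refine ⟨(hper p).2 h1, (hper q).2 h2, by omega, fun j hj₁ hj₂ hj => ?_⟩
    refine h4 (j - n) (by omega) (by omega) ((hper _).1 ?_)
    rwa [Nat.sub_add_cancel (by omega)]
  rcases hp.eq_or_lt with rfl | hp
  · rw [hg.1, hg'.1]
  · rw [hy.eq_of_isGap hg hp hq, hy.eq_of_isGap hg' (by omega) (by omega), Prod.mk.injEq,
      Prod.mk.injEq]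
    omega

end CMS

namespace CMS

theorem shiftMap_iterate_apply (n : ℕ) (x : Pt) (i : ℕ) : (shiftMap^[n] x) i = x (i + n) := by
  induction n generalizing x with
  | zero => rfl
  | succ n ih => rw [Function.iterate_succ_apply, ih]; rfl

theorem isAdmissible.shift {M : ℕ → ℕ → Prop} {x : Pt} (hx : isAdmissible M x) (n : ℕ) :
    isAdmissible M (shiftMap^[n] x) := fun i => by
  simpa only [shiftMap_iterate_apply, Nat.add_right_comm] using hx (i + n)

theorem shiftMap_iterate_eq_iff {n : ℕ} {x : Pt} :
    shiftMap^[n] x = x ↔ Function.Periodic x n := by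
  simp only [funext_iff, shiftMap_iterate_apply, Function.Periodic]

theorem IsBouquetWalk.mem_vertex {y : ℕ → ℕ × ℕ × ℕ} (hy : IsBouquetWalk y) (t : ℕ) :
    y t ∈ BouquetVertex (fun _ => 1) := by
  rcases hy.eq_root_or t with h | ⟨m, k, h1, h2, h⟩
  · exact Or.inl h
  · rw [h]
    exact Or.inr ⟨by simp; omega, le_rfl, le_rfl, h1, by simp; omega⟩

/-- The potential of the example, as a function on the bouquet shift presented by `M` and `e`. -/
structure IsBouquetPotential (M : ℕ → ℕ → Prop) (e : ℕ → ℕ × ℕ × ℕ) (φ : Pt → ℝ) : Prop where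
  root_root : ∀ x : Pt, isAdmissible M x →
    e (x 0) = (0, 0, 0) → e (x 1) = (0, 0, 0) → φ x = -Real.log 2
  root_loop : ∀ x : Pt, ∀ n i : ℕ, isAdmissible M x → 2 ≤ n →
    e (x 0) = (0, 0, 0) → e (x 1) = (n, i, 1) → φ x = -(n : ℝ) * Real.log 2
  other : ∀ x : Pt, isAdmissible M x → e (x 0) ≠ (0, 0, 0) → φ x = 0

/-- The transfer function making the potential cohomologous to the constant `-log 2`. -/
noncomputable def loopTransfer (v : ℕ × ℕ × ℕ) : ℝ := ((v.2.2 : ℝ) - v.1) * Real.log 2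

section

variable {M : ℕ → ℕ → Prop} {e : ℕ → ℕ × ℕ × ℕ}

theorem IsBouquet.walk (hbq : IsBouquet (fun _ => 1) M e) {x : Pt} (hx : isAdmissible M x) :
    IsBouquetWalk (fun t => e (x t)) := fun t => (hbq.2.2.2 _ _).1 (hx t)

theorem IsBouquet.exists_point (hbq : IsBouquet (fun _ => 1) M e) {y : ℕ → ℕ × ℕ × ℕ}
    (hy : IsBouquetWalk y) : ∃ x : Pt, isAdmissible M x ∧ ∀ t, e (x t) = y t := by
  have h : ∀ t, ∃ v, e v = y t := fun t => by
    have := hy.mem_vertex t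
    rwa [← hbq.2.1] at this
  choose x hx using h
  exact ⟨x, fun t => (hbq.2.2.2 _ _).2 (by rw [hx, hx]; exact hy t), hx⟩

variable {φ : Pt → ℝ}

theorem IsBouquetPotential.eq_transfer (hφ : IsBouquetPotential M e φ)
    (hbq : IsBouquet (fun _ => 1) M e) {x : Pt} (hx : isAdmissible M x) :
    φ x = -Real.log 2 + loopTransfer (e (x 1)) - loopTransfer (e (x 0)) := by
  rcases bouquetEdge_one_iff.1 (hbq.walk hx 0) with ⟨h0, h1⟩ | ⟨h0, n, hn, h1⟩ |
    ⟨n, k, hk, hkn, h0, h1⟩ | ⟨n, hn, h0, h1⟩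
  · rw [hφ.root_root x hx h0 h1]
    simp only [zero_add] at h0 h1
    rw [h0, h1]
    ring
  · rw [hφ.root_loop x n 1 hx hn h0 h1]
    simp only [zero_add] at h0 h1
    rw [h0, h1]
    simp only [loopTransfer]
    push_cast
    ring
  · simp only [zero_add] at h0 h1
    rw [hφ.other x hx (by rw [h0]; simp), h0, h1]
    simp only [loopTransfer]
    push_cast
    ring
  · simp only [zero_add] at h0 h1
    rw [hφ.other x hx (by rw [h0]; simp), h0, h1]
    simp only [loopTransfer]
    push_cast
    ring

theorem IsBouquetPotential.birkhoff_eq (hφ : IsBouquetPotential M e φ)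
    (hbq : IsBouquet (fun _ => 1) M e) {x : Pt} (hx : isAdmissible M x) (n : ℕ) :
    birkhoff φ n x =
      -(n : ℝ) * Real.log 2 + loopTransfer (e (x n)) - loopTransfer (e (x 0)) := by
  unfold birkhoff
  induction n with
  | zero => simp
  | succ n ih =>
    rw [Finset.sum_range_succ, ih, hφ.eq_transfer hbq (hx.shift n)]
    simp only [shiftMap_iterate_apply, zero_add, Nat.add_comm 1 n]
    push_cast
    ring

theorem IsBouquetPotential.birkhoff_periodic (hφ : IsBouquetPotential M e φ)
    (hbq : IsBouquet (fun _ => 1) M e) {x : Pt} (hx : isAdmissible M x) {n : ℕ}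
    (hn : shiftMap^[n] x = x) : birkhoff φ n x = -(n : ℝ) * Real.log 2 := by
  have h : x n = x 0 := by simpa using shiftMap_iterate_eq_iff.1 hn 0
  rw [hφ.birkhoff_eq hbq hx, h]
  ring

theorem IsBouquetPotential.nonpos (hφ : IsBouquetPotential M e φ)
    (hbq : IsBouquet (fun _ => 1) M e) {x : Pt} (hx : isAdmissible M x) : φ x ≤ 0 := by
  have hlog : 0 < Real.log 2 := Real.log_pos one_lt_two
  by_cases h0 : e (x 0) = (0, 0, 0)
  · rcases (hbq.walk hx).eq_root_or_of_root h0 with h1 | ⟨m, hm, h1⟩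
    · rw [hφ.root_root x hx h0 h1]
      linarith
    · rw [hφ.root_loop x m 1 hx hm h0 h1, neg_mul]
      exact neg_nonpos.2 (by positivity)
  · rw [hφ.other x hx h0]

theorem IsBouquetPotential.birkhoff_nonpos (hφ : IsBouquetPotential M e φ)
    (hbq : IsBouquet (fun _ => 1) M e) {x : Pt} (hx : isAdmissible M x) (n : ℕ) :
    birkhoff φ n x ≤ 0 :=
  Finset.sum_nonpos fun i _ => hφ.nonpos hbq (hx.shift i)

theorem IsBouquetPotential.exists_birkhoff_eq_zero (hφ : IsBouquetPotential M e φ)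
    (hbq : IsBouquet (fun _ => 1) M e) (htrans : TopTransitive M) {n : ℕ} (hn : 1 ≤ n) :
    ∃ x, isAdmissible M x ∧ birkhoff φ n x = 0 := by
  have hv : (n + 1, 1, 1) ∈ Set.range e := by
    rw [hbq.2.1]
    exact Or.inr ⟨by simp; omega, le_rfl, le_rfl, le_rfl, by simp; omega⟩
  obtain ⟨v, hv⟩ := hv
  obtain ⟨-, x, hx, h0, -⟩ := htrans v v
  have he : e (x 0) = (n + 1, 1, 1) := by rw [h0, hv]
  have hr : e (x (0 + (n + 1 - 1))) = (0, 0, 0) :=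
    (hbq.walk hx).root_of_mem_loop (by omega) he
  rw [zero_add, Nat.add_sub_cancel] at hr
  refine ⟨x, hx, ?_⟩
  rw [hφ.birkhoff_eq hbq hx, he, hr]
  simp only [loopTransfer]
  push_cast
  ring

theorem IsBouquet.eq_of_root_times (hbq : IsBouquet (fun _ => 1) M e) {x y : Pt}
    (hx : isAdmissible M x) (hy : isAdmissible M y) {n : ℕ} (hn : 0 < n)
    (hxn : shiftMap^[n] x = x) (hyn : shiftMap^[n] y = y)
    (h : ∀ i < n, e (x i) = (0, 0, 0) ↔ e (y i) = (0, 0, 0)) : x = y := by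
  have := (hbq.walk hx).ext_of_periodic (hbq.walk hy) hn
    (fun t => congrArg e (shiftMap_iterate_eq_iff.1 hxn t))
    (fun t => congrArg e (shiftMap_iterate_eq_iff.1 hyn t)) h
  exact funext fun t => hbq.1 (congrFun this t)

theorem IsBouquet.card_perSet_le (hbq : IsBouquet (fun _ => 1) M e) (b : ℕ) {n : ℕ} (hn : 0 < n) :
    ENat.card (PerSet M b n) ≤ 2 ^ n := by
  classical
  let F : PerSet M b n → Fin n → Bool := fun x i => decide (e (x.1 i) = (0, 0, 0))
  have hF : Function.Injective F := fun x y hxy => Subtype.ext <|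
    hbq.eq_of_root_times x.2.1 y.2.1 hn x.2.2.1 y.2.2.1 fun i hi => by
      simpa [F] using congrFun hxy ⟨i, hi⟩
  refine (ENat.card_le_card_of_injective hF).trans ?_
  rw [ENat.card_eq_coe_fintype_card]
  simp

theorem IsBouquet.card_perStarSet_le (hbq : IsBouquet (fun _ => 1) M e) {n : ℕ} (hn : 0 < n) :
    ENat.card (PerStarSet M 0 n) ≤ 1 := by
  rw [ENat.card_le_one_iff_subsingleton]
  refine ⟨fun x y => Subtype.ext <|
    hbq.eq_of_root_times x.2.1 y.2.1 hn x.2.2.1 y.2.2.1 fun i hi => ?_⟩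
  have key : ∀ z : PerStarSet M 0 n, e (z.1 i) = (0, 0, 0) ↔ i = 0 := fun z => by
    rw [← hbq.2.2.1, hbq.1.eq_iff]
    refine ⟨fun h => ?_, fun h => h ▸ z.2.2.2.1⟩
    by_contra h'
    exact z.2.2.2.2 i (Nat.pos_of_ne_zero h') hi h
  rw [key, key]

theorem IsBouquet.le_card_perSet (hbq : IsBouquet (fun _ => 1) M e) {b m k : ℕ} (hkm : k < m)
    (hb : (k = 0 ∧ e b = (0, 0, 0)) ∨ (1 ≤ k ∧ e b = (m, 1, k))) (l : ℕ) :
    2 ^ l ≤ ENat.card (PerSet M b (m + 1 + l)) := by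
  set n := m + 1 + l with hn
  let S : (Fin l → Bool) → ℕ → Prop := fun A s =>
    s % n = 0 ∨ s % n = m ∨ ∃ j : Fin l, A j = true ∧ s % n = m + 1 + j
  have hS0 : ∀ A, S A 0 := fun A => Or.inl (Nat.zero_mod n)
  have hSper : ∀ A s, S A (s + n) ↔ S A s := fun A s => by simp only [S, Nat.add_mod_right]
  have hSinf : ∀ A t, ∃ q, t < q ∧ S A q := fun A t =>
    ⟨(t + 1) * n, by nlinarith, Or.inl (Nat.mul_mod_left _ _)⟩
  have hpt : ∀ A, ∃ x : Pt, isAdmissible M x ∧ ∀ t, e (x t) = (0, 0, 0) ↔ S A t := fun A => by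
    obtain ⟨y, hy, hyS⟩ := exists_walk_of_root_times (hS0 A) (hSinf A)
    obtain ⟨x, hx, hxy⟩ := hbq.exists_point hy
    exact ⟨x, hx, fun t => by rw [hxy, hyS]⟩
  choose x hx hxS using hpt
  have hper : ∀ A, Function.Periodic (x A) n := fun A t => hbq.1 <|
    (hbq.walk (hx A)).periodic_of_root_times ((hxS A 0).2 (hS0 A))
      (fun s => by rw [hxS, hxS, hSper]) t
  have hxk : ∀ A, x A k = b := fun A => hbq.1 <| by
    rcases hb with ⟨rfl, hb⟩ | ⟨hk, hb⟩
    · rw [hb, hxS]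
      exact hS0 A
    · have hm : m % n = m := Nat.mod_eq_of_lt (by omega)
      have hg : IsGap (fun t => e (x A t) = (0, 0, 0)) 0 m := by
        refine ⟨(hxS A 0).2 (hS0 A), (hxS A m).2 (Or.inr (Or.inl hm)), by omega,
          fun j h1 h2 h => ?_⟩
        have hj : j % n = j := Nat.mod_eq_of_lt (by omega)
        rcases (hxS A j).1 h with h | h | ⟨i, -, h⟩ <;> omega
      rw [hb, (hbq.walk (hx A)).eq_of_isGap hg hk hkm, Nat.sub_zero, Nat.sub_zero]
  let F : (Fin l → Bool) → PerSet M b n := fun A => ⟨shiftMap^[k] (x A), (hx A).shift k, by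
    rw [shiftMap_iterate_eq_iff]
    intro t
    rw [shiftMap_iterate_apply, shiftMap_iterate_apply, Nat.add_right_comm]
    exact hper A _, by rw [shiftMap_iterate_apply, zero_add, hxk]⟩
  have hF : Function.Injective F := fun A B hAB => by
    have hroot : ∀ t, k ≤ t → (S A t ↔ S B t) := fun t ht => by
      have := congrFun (congrArg Subtype.val hAB) (t - k)
      simp only [F, shiftMap_iterate_apply, Nat.sub_add_cancel ht] at this
      rw [← hxS, ← hxS, this]
    have hmem : ∀ C (j : Fin l), S C (m + 1 + j) ↔ C j = true := fun C j => by
      have hj : (m + 1 + (j : ℕ)) % n = m + 1 + j := Nat.mod_eq_of_lt (by omega)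
      simp only [S, hj]
      constructor
      · rintro (h | h | ⟨i, hi, h⟩)
        · omega
        · omega
        · rwa [show j = i from Fin.ext (by omega)]
      · exact fun h => Or.inr (Or.inr ⟨j, h, rfl⟩)
    funext j
    rw [Bool.eq_iff_iff, ← hmem, ← hmem]
    exact hroot _ (by omega)
  refine le_trans ?_ (ENat.card_le_card_of_injective hF)
  rw [ENat.card_eq_coe_fintype_card]
  simp

theorem exp_neg_mul_log_two (n : ℕ) :
    ENNReal.ofReal (Real.exp (-(n : ℝ) * Real.log 2)) = 2⁻¹ ^ n := by
  rw [neg_mul, ← mul_neg, Real.exp_nat_mul, Real.exp_neg, Real.exp_log two_pos,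
    ENNReal.ofReal_pow (by norm_num), ENNReal.ofReal_inv_of_pos two_pos]
  simp

theorem IsBouquetPotential.Zn_eq (hφ : IsBouquetPotential M e φ)
    (hbq : IsBouquet (fun _ => 1) M e) (b n : ℕ) :
    Zn M φ b n = ENat.card (PerSet M b n) * 2⁻¹ ^ n := by
  rw [← ENNReal.tsum_const]
  exact tsum_congr fun x => by
    rw [hφ.birkhoff_periodic hbq x.2.1 x.2.2.1, exp_neg_mul_log_two]

theorem IsBouquetPotential.ZnStar_eq (hφ : IsBouquetPotential M e φ)
    (hbq : IsBouquet (fun _ => 1) M e) (b n : ℕ) :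
    ZnStar M φ b n = ENat.card (PerStarSet M b n) * 2⁻¹ ^ n := by
  rw [← ENNReal.tsum_const]
  exact tsum_congr fun x => by
    rw [hφ.birkhoff_periodic hbq x.2.1 x.2.2.1, exp_neg_mul_log_two]

theorem IsBouquetPotential.Zn_le_one (hφ : IsBouquetPotential M e φ)
    (hbq : IsBouquet (fun _ => 1) M e) (b : ℕ) {n : ℕ} (hn : 0 < n) : Zn M φ b n ≤ 1 := by
  have h := ENat.toENNReal_le.2 (hbq.card_perSet_le b hn)
  rw [hφ.Zn_eq hbq]
  refine (mul_le_mul_left h _).trans_eq ?_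
  simp only [ENat.toENNReal_pow, ENat.toENNReal_ofNat]
  rw [← mul_pow, ENNReal.mul_inv_cancel two_ne_zero ofNat_ne_top, one_pow]

theorem IsBouquetPotential.exists_le_Zn (hφ : IsBouquetPotential M e φ)
    (hbq : IsBouquet (fun _ => 1) M e) (b : ℕ) :
    ∃ m, ∀ l, (2⁻¹ : ℝ≥0∞) ^ m ≤ Zn M φ b (m + l) := by
  obtain ⟨m, k, hkm, hb⟩ : ∃ m k, k < m ∧
      ((k = 0 ∧ e b = (0, 0, 0)) ∨ (1 ≤ k ∧ e b = (m, 1, k))) := by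
    have hv : e b ∈ BouquetVertex (fun _ => 1) := hbq.2.1 ▸ Set.mem_range_self b
    rcases hv with h | ⟨h1, h2, h3, h4, h5⟩
    · exact ⟨1, 0, one_pos, Or.inl ⟨rfl, h⟩⟩
    · exact ⟨(e b).1, (e b).2.2, by omega,
        Or.inr ⟨h4, Prod.ext rfl (Prod.ext (le_antisymm h3 h2) rfl)⟩⟩
  refine ⟨m + 1, fun l => ?_⟩
  have h := ENat.toENNReal_le.2 (hbq.le_card_perSet hkm hb l)
  rw [hφ.Zn_eq hbq]
  refine le_trans (le_of_eq ?_) (mul_le_mul_left h _)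
  simp only [ENat.toENNReal_pow, ENat.toENNReal_ofNat]
  rw [pow_add _ (m + 1) l, mul_left_comm, ← mul_pow,
    ENNReal.mul_inv_cancel two_ne_zero ofNat_ne_top, one_pow, mul_one]

theorem IsBouquetPotential.pressureAt_eq_zero (hφ : IsBouquetPotential M e φ)
    (hbq : IsBouquet (fun _ => 1) M e) (b : ℕ) : pressureAt M φ b = 0 := by
  obtain ⟨m, hm⟩ := hφ.exists_le_Zn hbq b
  have hinv : ∀ n : ℕ, (0 : EReal) ≤ ((n : ℝ) : EReal)⁻¹ := fun n => by
    rw [← EReal.coe_inv]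
    exact_mod_cast inv_nonneg.2 (Nat.cast_nonneg n)
  have hlim : Tendsto (fun n : ℕ => ((n : ℝ)⁻¹ : EReal) * ENNReal.log (2⁻¹ ^ m)) atTop
      (nhds 0) := by
    have hne : (2⁻¹ : ℝ≥0∞) ^ m ≠ 0 := pow_ne_zero _ (ENNReal.inv_ne_zero.2 ofNat_ne_top)
    have hne' : (2⁻¹ : ℝ≥0∞) ^ m ≠ ⊤ := ENNReal.pow_ne_top (ENNReal.inv_ne_top.2 two_ne_zero)
    rw [ENNReal.log_pos_real hne hne']
    simp only [← EReal.coe_inv, ← EReal.coe_mul]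
    rw [← EReal.coe_zero, EReal.tendsto_coe]
    simpa using (tendsto_inv_atTop_nhds_zero_nat (𝕜 := ℝ)).mul_const
      (Real.log ((2⁻¹ : ℝ≥0∞) ^ m).toReal)
  refine (tendsto_of_tendsto_of_tendsto_of_le_of_le' hlim tendsto_const_nhds ?_ ?_).limsup_eq
  · filter_upwards [eventually_ge_atTop m] with n hn
    refine mul_le_mul_of_nonneg_left (ENNReal.log_monotone ?_) (hinv n)
    simpa [Nat.add_sub_cancel' hn] using hm (n - m)
  · filter_upwards [eventually_gt_atTop 0] with n hn
    exact mul_nonpos_of_nonneg_of_nonpos (hinv n)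
      (ENNReal.log_le_zero_iff.2 (hφ.Zn_le_one hbq b hn))

theorem IsBouquetPotential.tsum_Zn_eq_top (hφ : IsBouquetPotential M e φ)
    (hbq : IsBouquet (fun _ => 1) M e) (b : ℕ) : ∑' n : ℕ, Zn M φ b (n + 1) = ⊤ := by
  obtain ⟨m, hm⟩ := hφ.exists_le_Zn hbq b
  have hne : (2⁻¹ : ℝ≥0∞) ^ m ≠ 0 := pow_ne_zero _ (ENNReal.inv_ne_zero.2 ofNat_ne_top)
  rw [eq_top_iff, ← ENNReal.tsum_const_eq_top_of_ne_zero (α := ℕ) hne]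
  calc ∑' _ : ℕ, (2⁻¹ : ℝ≥0∞) ^ m ≤ ∑' l : ℕ, Zn M φ b (m + l + 1) :=
        ENNReal.tsum_le_tsum fun l => hm (l + 1)
    _ ≤ ∑' n : ℕ, Zn M φ b (n + 1) :=
        ENNReal.tsum_comp_le_tsum_of_injective (add_right_injective m)
          (fun n => Zn M φ b (n + 1))

theorem IsBouquetPotential.tsum_ZnStar_lt_top (hφ : IsBouquetPotential M e φ)
    (hbq : IsBouquet (fun _ => 1) M e) : ∑' n : ℕ, (n : ℝ≥0∞) * ZnStar M φ 0 n < ⊤ := by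
  have hsum : Summable fun n : ℕ => (n : ℝ) * 2⁻¹ ^ n := by
    simpa using summable_pow_mul_geometric_of_norm_lt_one (R := ℝ) 1 (r := 2⁻¹) (by norm_num)
  refine lt_of_le_of_lt (ENNReal.tsum_le_tsum fun n => ?_) hsum.tsum_ofReal_ne_top.lt_top
  rcases Nat.eq_zero_or_pos n with rfl | hn
  · simp
  · have h := ENat.toENNReal_le.2 (hbq.card_perStarSet_le hn)
    rw [ENNReal.ofReal_mul (Nat.cast_nonneg n), ENNReal.ofReal_natCast,
      ENNReal.ofReal_pow (by norm_num), ENNReal.ofReal_inv_of_pos two_pos, hφ.ZnStar_eq hbq]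
    refine mul_le_mul_right ?_ _
    simpa using mul_le_mul_left h ((2⁻¹ : ℝ≥0∞) ^ n)

theorem IsBouquetPotential.birkhoff_div (hφ : IsBouquetPotential M e φ)
    (hbq : IsBouquet (fun _ => 1) M e) {x : Pt} {n : ℕ} (hx : isAdmissible M x) (hn : 0 < n)
    (hxn : shiftMap^[n] x = x) : birkhoff φ n x / (n : ℝ) = -Real.log 2 := by
  have : (n : ℝ) ≠ 0 := by positivity
  rw [hφ.birkhoff_periodic hbq hx hxn]
  field_simp

theorem IsBouquetPotential.chiPer_eq (hφ : IsBouquetPotential M e φ)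
    (hbq : IsBouquet (fun _ => 1) M e) : chiPer M φ = ((-Real.log 2 : ℝ) : EReal) := by
  have hroot : isAdmissible M (fun _ => 0) := fun _ =>
    (hbq.2.2.2 _ _).2 (Or.inl ⟨hbq.2.2.1, hbq.2.2.1, rfl⟩)
  have : Nonempty {p : Pt × ℕ // isAdmissible M p.1 ∧ 0 < p.2 ∧ shiftMap^[p.2] p.1 = p.1} :=
    ⟨⟨(fun _ => 0, 1), hroot, one_pos, rfl⟩⟩
  unfold chiPer
  rw [iSup_congr fun p => congrArg Real.toEReal (hφ.birkhoff_div hbq p.2.1 p.2.2.1 p.2.2.2),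
    iSup_const]

end

end CMS

open CMS

/-- Section `ssec:UCSweak`: (UCS) is a weak condition.
Let `Σ_V` be the bouquet shift with `a n = 1` for all `n ≥ 1`, and let
`φ : Σ_V → ℝ` equal `-log 2` on `[r r]`, `-n log 2` on `[r v_1^{n,1}]` for each
`n ≥ 2`, and `0` elsewhere.  Then:
(i) the Gurevich pressure is `P(φ) = 0`;
(ii) `φ` is positive recurrent
(`∑_n Z_n(φ,r) = ∞` and `∑_n n Z_n^*(φ,r) < ∞`, the factors `e^{-n P(φ)}` being `1`);
(iii) every periodic point of period `n` has Birkhoff average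
`(1/n) S_n φ(x) = -log 2`, so `χ_per(φ) = -log 2 < 0 = P(φ)` and (UCS) holds;
(iv) for every `n ≥ 1`, `sup_{x ∈ Σ_V} S_n φ(x) = 0`, hence the hyperbolicity
condition `∃ n, sup_x S_n φ(x)/n < P(φ)` fails. -/
theorem bouquet_UCS_weak_example
    (M : ℕ → ℕ → Prop) (e : ℕ → ℕ × ℕ × ℕ)
    (hbq : IsBouquet (fun _ => 1) M e)
    (htrans : TopTransitive M)
    (φ : Pt → ℝ)
    (hrr : ∀ x : Pt, isAdmissible M x →
      e (x 0) = (0, 0, 0) → e (x 1) = (0, 0, 0) → φ x = -Real.log 2)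
    (hrv : ∀ x : Pt, ∀ n i : ℕ, isAdmissible M x → 2 ≤ n →
      e (x 0) = (0, 0, 0) → e (x 1) = (n, i, 1) → φ x = -(n : ℝ) * Real.log 2)
    (helse : ∀ x : Pt, isAdmissible M x → e (x 0) ≠ (0, 0, 0) → φ x = 0) :
    (∀ b : ℕ, pressureAt M φ b = (0 : EReal)) ∧
    ((∑' n : ℕ, Zn M φ 0 (n + 1)) = ⊤ ∧ (∑' n : ℕ, (n : ℝ≥0∞) * ZnStar M φ 0 n) < ⊤) ∧
    ((∀ x : Pt, ∀ n : ℕ, isAdmissible M x → 0 < n → shiftMap^[n] x = x →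
        birkhoff φ n x / (n : ℝ) = -Real.log 2) ∧
      chiPer M φ = ((-Real.log 2 : ℝ) : EReal) ∧ chiPer M φ < (0 : EReal)) ∧
    ((∀ n : ℕ, 1 ≤ n →
        (⨆ x : {x : Pt // isAdmissible M x}, ((birkhoff φ n x.1 : ℝ) : EReal)) = 0) ∧
      ¬ ∃ n : ℕ, 1 ≤ n ∧
        (⨆ x : {x : Pt // isAdmissible M x},
          ((birkhoff φ n x.1 / (n : ℝ) : ℝ) : EReal)) < (0 : EReal)) := by
  have hφ : IsBouquetPotential M e φ := ⟨hrr, hrv, helse⟩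
  have hlog : 0 < Real.log 2 := Real.log_pos one_lt_two
  refine ⟨hφ.pressureAt_eq_zero hbq, ⟨hφ.tsum_Zn_eq_top hbq 0, hφ.tsum_ZnStar_lt_top hbq⟩,
    ⟨fun x n => hφ.birkhoff_div hbq, hφ.chiPer_eq hbq, ?_⟩, fun n hn => le_antisymm ?_ ?_, ?_⟩
  · rw [hφ.chiPer_eq hbq]
    exact_mod_cast neg_lt_zero.2 hlog
  · exact iSup_le fun x => by exact_mod_cast hφ.birkhoff_nonpos hbq x.2 n
  · obtain ⟨x, hx, h⟩ := hφ.exists_birkhoff_eq_zero hbq htrans hn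
    exact le_iSup_of_le ⟨x, hx⟩ (by simp [h])
  · rintro ⟨n, hn, hlt⟩
    obtain ⟨x, hx, h⟩ := hφ.exists_birkhoff_eq_zero hbq htrans hn
    exact hlt.not_ge (le_iSup_of_le ⟨x, hx⟩ (by simp [h]))
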